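/- Let K ⊆ ℝ^d be measurable, let a, b : K → [0, ∞) be probability densities on K, let μ_p, μ_q : K → ℝ^d be measurable with sup_{x,y ∈ K} ‖μ_p(x) − μ_q(y)‖ ≤ M for some M ≥ 0, and let 0 < η ≤ (2π)^{−1/2} e^{−1/6}. Define the Gaussian mixture densities p(x) = ∫_K a(y) N(x | μ_p(y), η² I_d) dy and q(x) = ∫_K b(y) N(x | μ_q(y), η² I_d) dy on ℝ^d. Then d_KL(p, q) ≤ M²/(2η²). -/

import Mathlib

open MeasureTheory Real Set

/-- The multivariate Gaussian density `N(x | μ, s·I_d)` on `ℝ^d` (with scalar covariance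
`s = σ²`): `(2πs)^(-d/2) exp (-‖x-μ‖²/(2s))`. -/
noncomputable def gaussDensity {d : ℕ} (μ : EuclideanSpace ℝ (Fin d)) (s : ℝ)
    (x : EuclideanSpace ℝ (Fin d)) : ℝ :=
  (2 * π * s) ^ (-(d : ℝ) / 2) * Real.exp (-‖x - μ‖ ^ 2 / (2 * s))

/-- Kullback–Leibler divergence `∫ p(x) log (p(x)/q(x)) dx` between densities on `ℝ^d`. -/
noncomputable def klDiv {d : ℕ} (p q : EuclideanSpace ℝ (Fin d) → ℝ) : ℝ :=
  ∫ x, p x * Real.log (p x / q x)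

open scoped RealInnerProductSpace

section GaussDensity

variable {d : ℕ} {s : ℝ}

lemma gaussDensity_eq_sub (μ : EuclideanSpace ℝ (Fin d)) (s : ℝ) (x : EuclideanSpace ℝ (Fin d)) :
    gaussDensity μ s x = gaussDensity 0 s (x - μ) := by
  simp [gaussDensity]

lemma gaussDensity_pos (hs : 0 < s) (μ x : EuclideanSpace ℝ (Fin d)) :
    0 < gaussDensity μ s x := by
  unfold gaussDensity
  positivity

lemma gaussDensity_le (hs : 0 < s) (μ x : EuclideanSpace ℝ (Fin d)) :
    gaussDensity μ s x ≤ (2 * π * s) ^ (-(d : ℝ) / 2) := by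
  unfold gaussDensity
  refine mul_le_of_le_one_right (by positivity) (Real.exp_le_one_iff.2 ?_)
  rw [neg_div]
  exact neg_nonpos.2 (by positivity)

@[fun_prop]
lemma measurable_gaussDensity {α : Type*} [MeasurableSpace α]
    {f g : α → EuclideanSpace ℝ (Fin d)} (hf : Measurable f) (hg : Measurable g) :
    Measurable fun a ↦ gaussDensity (f a) s (g a) := by
  unfold gaussDensity
  fun_prop

lemma integrable_rexp_neg_mul_sq_norm {b : ℝ} (hb : 0 < b) :
    Integrable fun x : EuclideanSpace ℝ (Fin d) ↦ Real.exp (-b * ‖x‖ ^ 2) := by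
  have h := (GaussianFourier.integrable_cexp_neg_mul_sq_norm_add (V := EuclideanSpace ℝ (Fin d))
    (b := (b : ℂ)) (by simpa using hb) 0 0).norm
  refine h.congr (Filter.Eventually.of_forall fun x ↦ ?_)
  simp only [Complex.norm_exp]
  norm_cast
  simp

lemma gaussDensity_zero (s : ℝ) (x : EuclideanSpace ℝ (Fin d)) :
    gaussDensity 0 s x = (2 * π * s) ^ (-(d : ℝ) / 2) * Real.exp (-(2 * s)⁻¹ * ‖x‖ ^ 2) := by
  simp only [gaussDensity, sub_zero]
  congr 2
  ring

lemma integrable_gaussDensity_zero (hs : 0 < s) :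
    Integrable (gaussDensity (0 : EuclideanSpace ℝ (Fin d)) s) := by
  simp_rw [funext (gaussDensity_zero s)]
  exact (integrable_rexp_neg_mul_sq_norm (by positivity)).const_mul _

lemma integral_gaussDensity_zero (hs : 0 < s) :
    ∫ x, gaussDensity (0 : EuclideanSpace ℝ (Fin d)) s x = 1 := by
  simp_rw [gaussDensity_zero s]
  rw [integral_const_mul, GaussianFourier.integral_rexp_neg_mul_sq_norm (by positivity),
    finrank_euclideanSpace_fin, div_inv_eq_mul, show π * (2 * s) = 2 * π * s by ring,
    ← Real.rpow_add (by positivity)]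
  simp [neg_div]

lemma integrable_gaussDensity_zero_mul_norm (hs : 0 < s) :
    Integrable fun x : EuclideanSpace ℝ (Fin d) ↦ gaussDensity 0 s x * ‖x‖ := by
  set b : ℝ := (2 * s)⁻¹ with hb
  have hb0 : 0 < b := by positivity
  have hint := (integrable_rexp_neg_mul_sq_norm (d := d) (half_pos hb0)).const_mul
    ((2 * π * s) ^ (-(d : ℝ) / 2) * (1 + b⁻¹))
  refine hint.mono' (by fun_prop) (Filter.Eventually.of_forall fun x ↦ ?_)
  rw [Real.norm_of_nonneg (mul_nonneg (gaussDensity_pos hs _ _).le (norm_nonneg _)),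
    gaussDensity_zero, ← hb,
    mul_assoc ((2 * π * s) ^ (-(d : ℝ) / 2)), mul_assoc ((2 * π * s) ^ (-(d : ℝ) / 2))]
  refine mul_le_mul_of_nonneg_left ?_ (by positivity)
  have hsplit : Real.exp (-(b / 2) * ‖x‖ ^ 2)
      = Real.exp (-b * ‖x‖ ^ 2) * Real.exp (b / 2 * ‖x‖ ^ 2) := by
    rw [← Real.exp_add]
    congr 1
    ring
  rw [hsplit, mul_left_comm]
  refine mul_le_mul_of_nonneg_left ?_ (Real.exp_pos _).le
  calc ‖x‖ ≤ 1 + ‖x‖ ^ 2 / 2 := by nlinarith [sq_nonneg (‖x‖ - 1)]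
    _ ≤ (1 + b⁻¹) * (b / 2 * ‖x‖ ^ 2 + 1) := by
      have h1 : b⁻¹ * (b / 2 * ‖x‖ ^ 2) = ‖x‖ ^ 2 / 2 := by field_simp
      have h2 : 0 < b⁻¹ := by positivity
      have h3 : 0 ≤ b / 2 * ‖x‖ ^ 2 := by positivity
      linarith
    _ ≤ _ := mul_le_mul_of_nonneg_left (Real.add_one_le_exp _) (by positivity)

lemma integral_gaussDensity_zero_mul_inner (s : ℝ) (w : EuclideanSpace ℝ (Fin d)) :
    ∫ x, gaussDensity (0 : EuclideanSpace ℝ (Fin d)) s x * ⟪x, w⟫ = 0 := by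
  have h := integral_neg_eq_self
    (fun x : EuclideanSpace ℝ (Fin d) ↦ gaussDensity 0 s x * ⟪x, w⟫) volume
  have hodd : ∀ x : EuclideanSpace ℝ (Fin d),
      gaussDensity 0 s (-x) * ⟪-x, w⟫ = -(gaussDensity 0 s x * ⟪x, w⟫) := by
    intro x
    simp [gaussDensity, inner_neg_left]
  simp_rw [hodd] at h
  rw [integral_neg] at h
  linarith

/-- Logarithm of `gaussDensity u s x / gaussDensity v s x`. -/
noncomputable def gaussLogRatio (s : ℝ) (u v x : EuclideanSpace ℝ (Fin d)) : ℝ :=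
  (2 * ⟪x - u, u - v⟫ + ‖u - v‖ ^ 2) / (2 * s)

lemma gaussDensity_eq_mul_exp (u v x : EuclideanSpace ℝ (Fin d)) :
    gaussDensity v s x = gaussDensity u s x * Real.exp (-gaussLogRatio s u v x) := by
  have h : ‖x - v‖ ^ 2 = ‖x - u‖ ^ 2 + 2 * ⟪x - u, u - v⟫ + ‖u - v‖ ^ 2 := by
    rw [← norm_add_sq_real, sub_add_sub_cancel]
  rw [gaussDensity, gaussDensity, gaussLogRatio,
    mul_assoc ((2 * π * s) ^ (-(d : ℝ) / 2)), ← Real.exp_add, h]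
  congr 2
  ring

lemma gaussDensity_mul_log_add_sub_le (hs : 0 < s) (u v x : EuclideanSpace ℝ (Fin d)) {t : ℝ}
    (ht : 0 < t) :
    gaussDensity u s x * Real.log t + gaussDensity u s x - t * gaussDensity v s x
      ≤ gaussDensity u s x * gaussLogRatio s u v x := by
  have h := Real.add_one_le_exp (Real.log t - gaussLogRatio s u v x)
  rw [sub_eq_add_neg, Real.exp_add, Real.exp_log ht] at h
  rw [gaussDensity_eq_mul_exp u v x]
  nlinarith [mul_le_mul_of_nonneg_left h (gaussDensity_pos hs u x).le]

lemma abs_gaussLogRatio_le (hs : 0 < s) {u v : EuclideanSpace ℝ (Fin d)} {M : ℝ}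
    (h : ‖u - v‖ ≤ M) (x : EuclideanSpace ℝ (Fin d)) :
    |gaussLogRatio s u v x| ≤ (2 * (‖x - u‖ * M) + M ^ 2) / (2 * s) := by
  rw [gaussLogRatio, abs_div, abs_of_pos (show 0 < 2 * s by positivity)]
  gcongr
  refine (abs_add_le _ _).trans ?_
  rw [abs_mul, abs_two, abs_of_nonneg (sq_nonneg ‖u - v‖)]
  gcongr
  exact (abs_real_inner_le_norm _ _).trans (by gcongr)

lemma integral_gaussDensity_mul_gaussLogRatio (hs : 0 < s) (u v : EuclideanSpace ℝ (Fin d)) :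
    ∫ x, gaussDensity u s x * gaussLogRatio s u v x = ‖u - v‖ ^ 2 / (2 * s) := by
  have hI : Integrable fun x : EuclideanSpace ℝ (Fin d) ↦ gaussDensity 0 s x * ⟪x, u - v⟫ := by
    refine ((integrable_gaussDensity_zero_mul_norm hs).mul_const ‖u - v‖).mono' (by fun_prop)
      (Filter.Eventually.of_forall fun x ↦ ?_)
    rw [norm_mul, Real.norm_of_nonneg (gaussDensity_pos hs _ _).le, mul_assoc]
    exact mul_le_mul_of_nonneg_left (norm_inner_le_norm _ _) (gaussDensity_pos hs _ _).le
  calc ∫ x, gaussDensity u s x * gaussLogRatio s u v x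
      = ∫ x, gaussDensity 0 s (x - u) * ((2 * ⟪x - u, u - v⟫ + ‖u - v‖ ^ 2) / (2 * s)) := by
        simp_rw [gaussDensity_eq_sub u, gaussLogRatio]
    _ = ∫ x, gaussDensity 0 s x * ((2 * ⟪x, u - v⟫ + ‖u - v‖ ^ 2) / (2 * s)) :=
        integral_sub_right_eq_self (fun x : EuclideanSpace ℝ (Fin d) ↦
          gaussDensity 0 s x * ((2 * ⟪x, u - v⟫ + ‖u - v‖ ^ 2) / (2 * s))) u
    _ = ∫ x, (s⁻¹ * (gaussDensity 0 s x * ⟪x, u - v⟫)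
          + gaussDensity 0 s x * (‖u - v‖ ^ 2 / (2 * s))) := by
        congr 1 with x
        field_simp
    _ = ‖u - v‖ ^ 2 / (2 * s) := by
        rw [integral_add (hI.const_mul _) ((integrable_gaussDensity_zero hs).mul_const _),
          integral_const_mul, integral_mul_const, integral_gaussDensity_zero_mul_inner,
          integral_gaussDensity_zero hs]
        ring

end GaussDensity

section Mixture

variable {d : ℕ} {Ω : Type*} [MeasurableSpace Ω] {P : Measure Ω}
  {u v : Ω → EuclideanSpace ℝ (Fin d)} {s M : ℝ}

lemma integrable_comp_sub_prod [IsFiniteMeasure P] {H : EuclideanSpace ℝ (Fin d) → ℝ}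
    (hHm : Measurable H) (hH : Integrable H) (hu : Measurable u) :
    Integrable (fun z : EuclideanSpace ℝ (Fin d) × Ω ↦ H (z.1 - u z.2)) (volume.prod P) := by
  refine (integrable_prod_iff' (Measurable.aestronglyMeasurable (by fun_prop))).2
    ⟨Filter.Eventually.of_forall fun ω ↦ hH.comp_sub_right (u ω), ?_⟩
  simp only [integral_sub_right_eq_self (‖H ·‖)]
  exact integrable_const _

lemma integrable_gaussDensity_mul_gaussLogRatio_prod [IsFiniteMeasure P] (hs : 0 < s)
    (hu : Measurable u) (hv : Measurable v) (hM : ∀ᵐ ω ∂P, ‖u ω - v ω‖ ≤ M) :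
    Integrable (fun z : EuclideanSpace ℝ (Fin d) × Ω ↦
      gaussDensity (u z.2) s z.1 * gaussLogRatio s (u z.2) (v z.2) z.1) (volume.prod P) := by
  have hH : Integrable fun x : EuclideanSpace ℝ (Fin d) ↦
      gaussDensity 0 s x * ((2 * (‖x‖ * M) + M ^ 2) / (2 * s)) := by
    refine (((integrable_gaussDensity_zero_mul_norm hs).mul_const (M / s)).add
      ((integrable_gaussDensity_zero hs).mul_const (M ^ 2 / (2 * s)))).congr
      (Filter.Eventually.of_forall fun x ↦ ?_)
    simp only [Pi.add_apply]
    field_simp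
  refine (integrable_comp_sub_prod (by fun_prop) hH hu).mono' ?_ ?_
  · unfold gaussLogRatio
    fun_prop
  · filter_upwards [Measure.quasiMeasurePreserving_snd.ae hM] with z hz
    rw [norm_mul, Real.norm_of_nonneg (gaussDensity_pos hs _ _).le, gaussDensity_eq_sub]
    exact mul_le_mul_of_nonneg_left (abs_gaussLogRatio_le hs hz _) (gaussDensity_pos hs _ _).le

lemma integrable_gaussDensity_mixture [IsFiniteMeasure P] (hs : 0 < s) (hu : Measurable u)
    (x : EuclideanSpace ℝ (Fin d)) : Integrable (fun ω ↦ gaussDensity (u ω) s x) P := by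
  refine (integrable_const ((2 * π * s) ^ (-(d : ℝ) / 2))).mono'
    (measurable_gaussDensity hu measurable_const).aestronglyMeasurable (Filter.Eventually.of_forall fun ω ↦ ?_)
  rw [Real.norm_of_nonneg (gaussDensity_pos hs _ _).le]
  exact gaussDensity_le hs _ _

lemma integral_gaussDensity_mixture_pos [IsProbabilityMeasure P] (hs : 0 < s) (hu : Measurable u)
    (x : EuclideanSpace ℝ (Fin d)) : 0 < ∫ ω, gaussDensity (u ω) s x ∂P := by
  rw [integral_pos_iff_support_of_nonneg (fun ω ↦ (gaussDensity_pos hs _ _).le)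
    (integrable_gaussDensity_mixture hs hu x),
    Function.support_eq_univ fun ω ↦ (gaussDensity_pos hs (u ω) x).ne']
  simp

/-- Mixtures of `gaussDensity (u ω) s` and `gaussDensity (v ω) s` over one probability space
have divergence at most `M ^ 2 / (2 * s)` when `u` and `v` are almost surely `M`-close. -/
theorem klDiv_gaussDensity_mixture_le [IsProbabilityMeasure P] (hs : 0 < s) (hu : Measurable u)
    (hv : Measurable v) (hM : ∀ᵐ ω ∂P, ‖u ω - v ω‖ ≤ M) :
    klDiv (fun x ↦ ∫ ω, gaussDensity (u ω) s x ∂P) (fun x ↦ ∫ ω, gaussDensity (v ω) s x ∂P)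
      ≤ M ^ 2 / (2 * s) := by
  rw [klDiv]
  by_cases hI : Integrable fun x ↦ (∫ ω, gaussDensity (u ω) s x ∂P)
      * Real.log ((∫ ω, gaussDensity (u ω) s x ∂P) / ∫ ω, gaussDensity (v ω) s x ∂P)
  swap
  · rw [integral_undef hI]
    positivity
  have hG := integrable_gaussDensity_mul_gaussLogRatio_prod hs hu hv hM
  calc _ ≤ ∫ x, ∫ ω, gaussDensity (u ω) s x * gaussLogRatio s (u ω) (v ω) x ∂P := by
        refine integral_mono_ae hI hG.integral_prod_left ?_
        filter_upwards [hG.prod_right_ae] with x hx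
        have hp := integral_gaussDensity_mixture_pos (P := P) hs hu x
        have hq := integral_gaussDensity_mixture_pos (P := P) hs hv x
        have hpi := integrable_gaussDensity_mixture (P := P) hs hu x
        have hqi := integrable_gaussDensity_mixture (P := P) hs hv x
        set p := ∫ ω, gaussDensity (u ω) s x ∂P with hp_def
        set q := ∫ ω, gaussDensity (v ω) s x ∂P with hq_def
        have hmono := integral_mono
          (((hpi.mul_const (Real.log (p / q))).add hpi).sub (hqi.const_mul (p / q))) hx
          fun ω ↦ gaussDensity_mul_log_add_sub_le hs (u ω) (v ω) x (div_pos hp hq)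
        rw [integral_sub' ((hpi.mul_const _).add hpi) (hqi.const_mul _),
          integral_add' (hpi.mul_const _) hpi, integral_mul_const, integral_const_mul,
          ← hp_def, ← hq_def, div_mul_cancel₀ _ hq.ne'] at hmono
        linarith
    _ = ∫ ω, ‖u ω - v ω‖ ^ 2 / (2 * s) ∂P := by
        rw [integral_integral_swap hG]
        simp_rw [integral_gaussDensity_mul_gaussLogRatio hs]
    _ ≤ ∫ _, M ^ 2 / (2 * s) ∂P := by
        refine integral_mono_of_nonneg (Filter.Eventually.of_forall fun ω ↦ by positivity)
          (integrable_const _) ?_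
        filter_upwards [hM] with ω hω
        gcongr
    _ = M ^ 2 / (2 * s) := by simp

end Mixture

section WeightedMeasure

variable {α : Type*} [MeasurableSpace α] {μ : Measure α} {K : Set α} {a : α → ℝ}

lemma integral_restrict_withDensity_ofReal (hK : MeasurableSet K) (ha : Measurable a)
    (ha0 : ∀ y ∈ K, 0 ≤ a y) (f : α → ℝ) :
    ∫ y, f y ∂(μ.restrict K).withDensity (fun y ↦ ENNReal.ofReal (a y))
      = ∫ y in K, a y * f y ∂μ := by
  rw [integral_withDensity_eq_integral_toReal_smul ha.ennreal_ofReal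
    (Filter.Eventually.of_forall fun _ ↦ ENNReal.ofReal_lt_top)]
  refine setIntegral_congr_fun hK fun y hy ↦ ?_
  simp [ENNReal.toReal_ofReal (ha0 y hy)]

lemma isProbabilityMeasure_restrict_withDensity_ofReal (hK : MeasurableSet K)
    (ha0 : ∀ y ∈ K, 0 ≤ a y) (ha1 : ∫ y in K, a y ∂μ = 1) :
    IsProbabilityMeasure ((μ.restrict K).withDensity fun y ↦ ENNReal.ofReal (a y)) := by
  refine ⟨?_⟩
  rw [withDensity_apply _ MeasurableSet.univ, Measure.restrict_univ,
    ← ofReal_integral_eq_lintegral_ofReal (Integrable.of_integral_ne_zero (by simp [ha1]))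
    (ae_restrict_of_forall_mem hK ha0), ha1, ENNReal.ofReal_one]

lemma ae_mem_restrict_withDensity (hK : MeasurableSet K) (g : α → ENNReal) :
    ∀ᵐ y ∂(μ.restrict K).withDensity g, y ∈ K :=
  (withDensity_absolutelyContinuous _ _).ae_le (ae_restrict_mem hK)

end WeightedMeasure

/-- KL bound between two Gaussian mixtures with common component
covariance `η² I_d`, component means pairwise at distance at most `M`, and small step
size `η ≤ (2π)^(-1/2) e^(-1/6)`: the KL divergence is at most `M²/(2η²)`. -/
theorem stmt4 (d : ℕ) (K : Set (EuclideanSpace ℝ (Fin d))) (hK : MeasurableSet K)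
    (a b : EuclideanSpace ℝ (Fin d) → ℝ)
    (hameas : Measurable a) (hbmeas : Measurable b)
    (ha0 : ∀ y ∈ K, 0 ≤ a y) (hb0 : ∀ y ∈ K, 0 ≤ b y)
    (ha1 : (∫ y in K, a y) = 1) (hb1 : (∫ y in K, b y) = 1)
    (μp μq : EuclideanSpace ℝ (Fin d) → EuclideanSpace ℝ (Fin d))
    (hμp : Measurable μp) (hμq : Measurable μq)
    (M : ℝ) (hM : 0 ≤ M)
    (hmeans : ∀ x ∈ K, ∀ y ∈ K, ‖μp x - μq y‖ ≤ M)
    (η : ℝ) (hη : 0 < η)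
    (hηsmall : η ≤ (2 * π) ^ (-(1 : ℝ) / 2) * Real.exp (-1 / 6)) :
    klDiv (fun x => ∫ y in K, a y * gaussDensity (μp y) (η ^ 2) x)
          (fun x => ∫ y in K, b y * gaussDensity (μq y) (η ^ 2) x) ≤
      M ^ 2 / (2 * η ^ 2) := by
  set α := (volume.restrict K).withDensity (fun y ↦ ENNReal.ofReal (a y)) with hα
  set β := (volume.restrict K).withDensity (fun y ↦ ENNReal.ofReal (b y)) with hβ
  have : IsProbabilityMeasure α := isProbabilityMeasure_restrict_withDensity_ofReal hK ha0 ha1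
  have : IsProbabilityMeasure β := isProbabilityMeasure_restrict_withDensity_ofReal hK hb0 hb1
  have hclose : ∀ᵐ ω ∂α.prod β, ‖μp ω.1 - μq ω.2‖ ≤ M := by
    filter_upwards [Measure.quasiMeasurePreserving_fst.ae (ae_mem_restrict_withDensity hK _),
      Measure.quasiMeasurePreserving_snd.ae (ae_mem_restrict_withDensity hK _)] with ω h1 h2
    exact hmeans _ h1 _ h2
  have h := klDiv_gaussDensity_mixture_le (pow_pos hη 2) (hμp.comp measurable_fst)
    (hμq.comp measurable_snd) hclose
  have hp : ∀ x, ∫ ω, gaussDensity (μp ω.1) (η ^ 2) x ∂α.prod β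
      = ∫ y in K, a y * gaussDensity (μp y) (η ^ 2) x := by
    intro x
    rw [integral_fun_fst (fun y ↦ gaussDensity (μp y) (η ^ 2) x), hα,
      integral_restrict_withDensity_ofReal hK hameas ha0]
    simp
  have hq : ∀ x, ∫ ω, gaussDensity (μq ω.2) (η ^ 2) x ∂α.prod β
      = ∫ y in K, b y * gaussDensity (μq y) (η ^ 2) x := by
    intro x
    rw [integral_fun_snd (fun y ↦ gaussDensity (μq y) (η ^ 2) x), hβ,
      integral_restrict_withDensity_ofReal hK hbmeas hb0]
    simp
  simpa only [Function.comp_apply, hp, hq] using h
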